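/- arXiv:0909.1486 — 5 statements merged into one kernel-verified Lean document; each statement's English description precedes it below -/
import Mathlib

section
/- Let 𝒜 carry all the data of a braided Ann-category and satisfy its axioms with the possible exception of the compatibility of the ⊕-functors (R^A, ℜ_{−,−,A}) with the associativity constraint a⁺. If for every object A the ⊕-functor (L^A, 𝔏_{A,−,−}) is compatible with a⁺ and diagram (6) holds, then for every object A the ⊕-functor (R^A, ℜ_{−,−,A}) is compatible with a⁺. Dually, the compatibility of each (L^A, 𝔏_{A,−,−}) with a⁺ follows from the compatibility of each (R^A, ℜ_{−,−,A}) with a⁺ together with diagram (6). -/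
open CategoryTheory

universe v u

namespace AnnCat

variable (C : Type u) [Category.{v} C]

/-- A bifunctor `C × C → C`, given by object and morphism assignments. -/
structure Bifunc where
  obj : C → C → C
  map : ∀ {A B X Y : C}, (A ⟶ B) → (X ⟶ Y) → (obj A X ⟶ obj B Y)
  map_id : ∀ (A X : C), map (𝟙 A) (𝟙 X) = 𝟙 (obj A X)
  map_comp : ∀ {A B E X Y Z : C} (f : A ⟶ B) (g : B ⟶ E) (h : X ⟶ Y) (k : Y ⟶ Z),
      map (f ≫ g) (h ≫ k) = map f h ≫ map g k

/-- All the data of a braided Ann-category: two bifunctors `⊕` (`pl`) and `⊗` (`tn`),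
objects `0`, `1`, and the natural isomorphisms
`a⁺` (`aP`), `c⁺` (`cP`), `g`, `d`, `a`, `l`, `r`, `𝔏` (`dl`), `ℜ` (`dr`) and the braiding `c` (`br`). -/
structure Data where
  pl : Bifunc C
  tn : Bifunc C
  zero : C
  one : C
  aP : ∀ A B X : C, pl.obj A (pl.obj B X) ≅ pl.obj (pl.obj A B) X
  cP : ∀ A B : C, pl.obj A B ≅ pl.obj B A
  g : ∀ A : C, pl.obj zero A ≅ A
  d : ∀ A : C, pl.obj A zero ≅ A
  a : ∀ A B X : C, tn.obj A (tn.obj B X) ≅ tn.obj (tn.obj A B) X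
  l : ∀ A : C, tn.obj one A ≅ A
  r : ∀ A : C, tn.obj A one ≅ A
  dl : ∀ A X Y : C, tn.obj A (pl.obj X Y) ≅ pl.obj (tn.obj A X) (tn.obj A Y)
  dr : ∀ X Y A : C, tn.obj (pl.obj X Y) A ≅ pl.obj (tn.obj X A) (tn.obj Y A)
  br : ∀ A B : C, tn.obj A B ≅ tn.obj B A
  natAP : ∀ {A A' B B' X X' : C} (f : A ⟶ A') (h : B ⟶ B') (k : X ⟶ X'),
      pl.map f (pl.map h k) ≫ (aP A' B' X').hom = (aP A B X).hom ≫ pl.map (pl.map f h) k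
  natCP : ∀ {A A' B B' : C} (f : A ⟶ A') (h : B ⟶ B'),
      pl.map f h ≫ (cP A' B').hom = (cP A B).hom ≫ pl.map h f
  natG : ∀ {A A' : C} (f : A ⟶ A'), pl.map (𝟙 zero) f ≫ (g A').hom = (g A).hom ≫ f
  natD : ∀ {A A' : C} (f : A ⟶ A'), pl.map f (𝟙 zero) ≫ (d A').hom = (d A).hom ≫ f
  natA : ∀ {A A' B B' X X' : C} (f : A ⟶ A') (h : B ⟶ B') (k : X ⟶ X'),
      tn.map f (tn.map h k) ≫ (a A' B' X').hom = (a A B X).hom ≫ tn.map (tn.map f h) k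
  natL : ∀ {A A' : C} (f : A ⟶ A'), tn.map (𝟙 one) f ≫ (l A').hom = (l A).hom ≫ f
  natR : ∀ {A A' : C} (f : A ⟶ A'), tn.map f (𝟙 one) ≫ (r A').hom = (r A).hom ≫ f
  natDL : ∀ {A A' X X' Y Y' : C} (f : A ⟶ A') (h : X ⟶ X') (k : Y ⟶ Y'),
      tn.map f (pl.map h k) ≫ (dl A' X' Y').hom
        = (dl A X Y).hom ≫ pl.map (tn.map f h) (tn.map f k)
  natDR : ∀ {X X' Y Y' A A' : C} (h : X ⟶ X') (k : Y ⟶ Y') (f : A ⟶ A'),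
      tn.map (pl.map h k) f ≫ (dr X' Y' A').hom
        = (dr X Y A).hom ≫ pl.map (tn.map h f) (tn.map k f)
  natBr : ∀ {A A' B B' : C} (f : A ⟶ A') (h : B ⟶ B'),
      tn.map f h ≫ (br A' B').hom = (br A B).hom ≫ tn.map h f

variable {C}

/-- The canonical "middle four interchange" morphism
`v : (U⊕V)⊕(Z⊕T) → (U⊕Z)⊕(V⊕T)` built from `a⁺`, `c⁺`, `id`. -/
def v (D : Data C) (U V Z T : C) :
    D.pl.obj (D.pl.obj U V) (D.pl.obj Z T) ⟶ D.pl.obj (D.pl.obj U Z) (D.pl.obj V T) :=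
  (D.aP U V (D.pl.obj Z T)).inv ≫
    D.pl.map (𝟙 U)
      ((D.aP V Z T).hom ≫ D.pl.map (D.cP V Z).hom (𝟙 T) ≫ (D.aP Z V T).inv) ≫
    (D.aP U Z (D.pl.obj V T)).hom

/-! Coherence axioms for `(𝒜, ⊕, a⁺, c⁺, (0,g,d))`. -/

def pentP (D : Data C) : Prop := ∀ W X Y Z : C,
  D.pl.map (𝟙 W) (D.aP X Y Z).hom ≫ (D.aP W (D.pl.obj X Y) Z).hom
      ≫ D.pl.map (D.aP W X Y).hom (𝟙 Z)
    = (D.aP W X (D.pl.obj Y Z)).hom ≫ (D.aP (D.pl.obj W X) Y Z).hom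

def triP (D : Data C) : Prop := ∀ X Y : C,
  (D.aP X D.zero Y).hom ≫ D.pl.map (D.d X).hom (𝟙 Y) = D.pl.map (𝟙 X) (D.g Y).hom

def hexP (D : Data C) : Prop := ∀ X Y Z : C,
  (D.aP X Y Z).inv ≫ (D.cP X (D.pl.obj Y Z)).hom ≫ (D.aP Y Z X).inv
    = D.pl.map (D.cP X Y).hom (𝟙 Z) ≫ (D.aP Y X Z).inv ≫ D.pl.map (𝟙 Y) (D.cP X Z).hom

def symP (D : Data C) : Prop := ∀ A B : C,
  (D.cP A B).hom ≫ (D.cP B A).hom = 𝟙 (D.pl.obj A B)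

/-- Every object has an inverse with respect to `⊕`. -/
def invObjP (D : Data C) : Prop := ∀ A : C, ∃ A' : C, Nonempty (D.pl.obj A A' ≅ D.zero)

/-- The underlying category is a groupoid. -/
def grpdP (C : Type u) [Category.{v} C] : Prop := ∀ {X Y : C} (f : X ⟶ Y), IsIso f

/-! Coherence axioms for `(𝒜, ⊗, a, (1,l,r))` and the braiding `c`. -/

def pentT (D : Data C) : Prop := ∀ W X Y Z : C,
  D.tn.map (𝟙 W) (D.a X Y Z).hom ≫ (D.a W (D.tn.obj X Y) Z).hom
      ≫ D.tn.map (D.a W X Y).hom (𝟙 Z)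
    = (D.a W X (D.tn.obj Y Z)).hom ≫ (D.a (D.tn.obj W X) Y Z).hom

def triT (D : Data C) : Prop := ∀ X Y : C,
  (D.a X D.one Y).hom ≫ D.tn.map (D.r X).hom (𝟙 Y) = D.tn.map (𝟙 X) (D.l Y).hom

/-- First hexagon axiom (B1) for the braiding. -/
def hexT1 (D : Data C) : Prop := ∀ X Y Z : C,
  (D.a X Y Z).inv ≫ (D.br X (D.tn.obj Y Z)).hom ≫ (D.a Y Z X).inv
    = D.tn.map (D.br X Y).hom (𝟙 Z) ≫ (D.a Y X Z).inv ≫ D.tn.map (𝟙 Y) (D.br X Z).hom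

/-- Second hexagon axiom (B2) for the braiding. -/
def hexT2 (D : Data C) : Prop := ∀ X Y Z : C,
  (D.a X Y Z).hom ≫ (D.br (D.tn.obj X Y) Z).hom ≫ (D.a Z X Y).hom
    = D.tn.map (𝟙 X) (D.br Y Z).hom ≫ (D.a X Z Y).hom ≫ D.tn.map (D.br X Z).hom (𝟙 Y)

/-- The braiding is a symmetry. -/
def symT (D : Data C) : Prop := ∀ A B : C,
  (D.br A B).hom ≫ (D.br B A).hom = 𝟙 (D.tn.obj A B)

/-- Compatibility of the braiding with the unit constraint `(1,l,r)`. -/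
def brUnit (D : Data C) : Prop := ∀ A : C,
  (D.br D.one A).hom ≫ (D.r A).hom = (D.l A).hom

/-! Axiom (Ann-1): compatibility of `(L^A, 𝔏)` and `(R^A, ℜ)` with `a⁺` and `c⁺`. -/

def compLaP (D : Data C) : Prop := ∀ A X Y Z : C,
  D.tn.map (𝟙 A) (D.aP X Y Z).hom ≫ (D.dl A (D.pl.obj X Y) Z).hom
      ≫ D.pl.map (D.dl A X Y).hom (𝟙 (D.tn.obj A Z))
    = (D.dl A X (D.pl.obj Y Z)).hom ≫ D.pl.map (𝟙 (D.tn.obj A X)) (D.dl A Y Z).hom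
      ≫ (D.aP (D.tn.obj A X) (D.tn.obj A Y) (D.tn.obj A Z)).hom

def compLcP (D : Data C) : Prop := ∀ A X Y : C,
  (D.dl A X Y).hom ≫ (D.cP (D.tn.obj A X) (D.tn.obj A Y)).hom
    = D.tn.map (𝟙 A) (D.cP X Y).hom ≫ (D.dl A Y X).hom

def compRaP (D : Data C) : Prop := ∀ X Y Z A : C,
  D.tn.map (D.aP X Y Z).hom (𝟙 A) ≫ (D.dr (D.pl.obj X Y) Z A).hom
      ≫ D.pl.map (D.dr X Y A).hom (𝟙 (D.tn.obj Z A))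
    = (D.dr X (D.pl.obj Y Z) A).hom ≫ D.pl.map (𝟙 (D.tn.obj X A)) (D.dr Y Z A).hom
      ≫ (D.aP (D.tn.obj X A) (D.tn.obj Y A) (D.tn.obj Z A)).hom

def compRcP (D : Data C) : Prop := ∀ X Y A : C,
  (D.dr X Y A).hom ≫ (D.cP (D.tn.obj X A) (D.tn.obj Y A)).hom
    = D.tn.map (D.cP X Y).hom (𝟙 A) ≫ (D.dr Y X A).hom

/-! Axiom (Ann-2): diagrams (1)-(4); axiom (Ann-3): diagrams (5.1), (5.2). -/

def diag1 (D : Data C) : Prop := ∀ A B X Y : C,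
  (D.a A B (D.pl.obj X Y)).hom ≫ (D.dl (D.tn.obj A B) X Y).hom
    = D.tn.map (𝟙 A) (D.dl B X Y).hom ≫ (D.dl A (D.tn.obj B X) (D.tn.obj B Y)).hom
      ≫ D.pl.map (D.a A B X).hom (D.a A B Y).hom

def diag2 (D : Data C) : Prop := ∀ X Y B A : C,
  (D.a (D.pl.obj X Y) B A).hom ≫ D.tn.map (D.dr X Y B).hom (𝟙 A)
      ≫ (D.dr (D.tn.obj X B) (D.tn.obj Y B) A).hom
    = (D.dr X Y (D.tn.obj B A)).hom ≫ D.pl.map (D.a X B A).hom (D.a Y B A).hom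

def diag3 (D : Data C) : Prop := ∀ A X Y B : C,
  (D.a A (D.pl.obj X Y) B).hom ≫ D.tn.map (D.dl A X Y).hom (𝟙 B)
      ≫ (D.dr (D.tn.obj A X) (D.tn.obj A Y) B).hom
    = D.tn.map (𝟙 A) (D.dr X Y B).hom ≫ (D.dl A (D.tn.obj X B) (D.tn.obj Y B)).hom
      ≫ D.pl.map (D.a A X B).hom (D.a A Y B).hom

def diag4 (D : Data C) : Prop := ∀ A B X Y : C,
  (D.dl (D.pl.obj A B) X Y).hom ≫ D.pl.map (D.dr A B X).hom (D.dr A B Y).hom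
      ≫ v D (D.tn.obj A X) (D.tn.obj B X) (D.tn.obj A Y) (D.tn.obj B Y)
    = (D.dr A B (D.pl.obj X Y)).hom ≫ D.pl.map (D.dl A X Y).hom (D.dl B X Y).hom

def diag51 (D : Data C) : Prop := ∀ X Y : C,
  (D.dl D.one X Y).hom ≫ D.pl.map (D.l X).hom (D.l Y).hom = (D.l (D.pl.obj X Y)).hom

def diag52 (D : Data C) : Prop := ∀ X Y : C,
  (D.dr X Y D.one).hom ≫ D.pl.map (D.r X).hom (D.r Y).hom = (D.r (D.pl.obj X Y)).hom

/-- Diagram (6) of a braided Ann-category: `(c_{A,X} ⊕ c_{A,Y}) ∘ 𝔏_{A,X,Y} = ℜ_{X,Y,A} ∘ c_{A,X⊕Y}`. -/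
def diag6 (D : Data C) : Prop := ∀ A X Y : C,
  (D.dl A X Y).hom ≫ D.pl.map (D.br A X).hom (D.br A Y).hom
    = (D.br A (D.pl.obj X Y)).hom ≫ (D.dr X Y A).hom

/-- The condition `c_{0,0} = id`. -/
def c00 (D : Data C) : Prop := (D.br D.zero D.zero).hom = 𝟙 (D.tn.obj D.zero D.zero)

/-- The axioms of an Ann-category. -/
structure IsAnn (D : Data C) : Prop where
  hPentP : pentP D
  hTriP : triP D
  hHexP : hexP D
  hSymP : symP D
  hGrpd : grpdP C
  hInv : invObjP D
  hPentT : pentT D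
  hTriT : triT D
  hCompLaP : compLaP D
  hCompLcP : compLcP D
  hCompRaP : compRaP D
  hCompRcP : compRcP D
  hD1 : diag1 D
  hD2 : diag2 D
  hD3 : diag3 D
  hD4 : diag4 D
  hD51 : diag51 D
  hD52 : diag52 D

/-- The axioms of a braided Ann-category. -/
structure IsBraidedAnn (D : Data C) extends IsAnn D : Prop where
  hHex1 : hexT1 D
  hHex2 : hexT2 D
  hD6 : diag6 D
  hC00 : c00 D

/-- A symmetric Ann-category: a braided Ann-category whose braiding is a symmetry. -/
def IsSymAnn (D : Data C) : Prop := IsBraidedAnn D ∧ symT D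

/-- `(L^A, 𝔏, L̂^A)` is a `⊕`-functor compatible with the unit constraints (a U-functor). -/
def isUL (D : Data C) (hatL : ∀ A : C, D.tn.obj A D.zero ≅ D.zero) : Prop := ∀ A X : C,
  ((D.dl A D.zero X).hom ≫ D.pl.map (hatL A).hom (𝟙 (D.tn.obj A X))
      ≫ (D.g (D.tn.obj A X)).hom = D.tn.map (𝟙 A) (D.g X).hom) ∧
  ((D.dl A X D.zero).hom ≫ D.pl.map (𝟙 (D.tn.obj A X)) (hatL A).hom
      ≫ (D.d (D.tn.obj A X)).hom = D.tn.map (𝟙 A) (D.d X).hom)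

/-- `(R^A, ℜ, R̂^A)` is a `⊕`-functor compatible with the unit constraints (a U-functor). -/
def isUR (D : Data C) (hatR : ∀ A : C, D.tn.obj D.zero A ≅ D.zero) : Prop := ∀ A X : C,
  ((D.dr D.zero X A).hom ≫ D.pl.map (hatR A).hom (𝟙 (D.tn.obj X A))
      ≫ (D.g (D.tn.obj X A)).hom = D.tn.map (D.g X).hom (𝟙 A)) ∧
  ((D.dr X D.zero A).hom ≫ D.pl.map (𝟙 (D.tn.obj X A)) (hatR A).hom
      ≫ (D.d (D.tn.obj X A)).hom = D.tn.map (D.d X).hom (𝟙 A))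

end AnnCat

namespace AnnCat

lemma Bifunc.map_comp_id {C : Type u} [Category.{v} C] (F : Bifunc C) {A B E : C}
    (f : A ⟶ B) (g : B ⟶ E) {X Y : C} (h : X ⟶ Y) :
    F.map f h ≫ F.map g (𝟙 Y) = F.map (f ≫ g) h := by
  rw [← F.map_comp, Category.comp_id]

lemma Bifunc.map_comp_id_left {C : Type u} [Category.{v} C] (F : Bifunc C) {A B E : C}
    (f : A ⟶ B) (g : B ⟶ E) {X Y : C} (h : X ⟶ Y) :
    F.map h f ≫ F.map (𝟙 Y) g = F.map h (f ≫ g) := by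
  rw [← F.map_comp, Category.comp_id]

lemma Bifunc.map_id_comp {C : Type u} [Category.{v} C] (F : Bifunc C) {A B E : C}
    (f : A ⟶ B) (g : B ⟶ E) {X Y : C} (h : X ⟶ Y) :
    F.map f (𝟙 X) ≫ F.map g h = F.map (f ≫ g) h := by
  rw [← F.map_comp, Category.id_comp]

lemma Bifunc.map_id_comp_left {C : Type u} [Category.{v} C] (F : Bifunc C) {A B E : C}
    (f : A ⟶ B) (g : B ⟶ E) {X Y : C} (h : X ⟶ Y) :
    F.map (𝟙 X) f ≫ F.map h g = F.map h (f ≫ g) := by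
  rw [← F.map_comp, Category.id_comp]

section

variable {C : Type u} [Category.{v} C] {D : Data C}

/-- Braiding carries the reassociate-then-distribute side of right compatibility to the left. -/
lemma br_comp_map_aP_dr (hD6 : diag6 D) (A X Y Z : C) :
    (D.br A _).hom ≫ D.tn.map (D.aP X Y Z).hom (𝟙 A) ≫ (D.dr (D.pl.obj X Y) Z A).hom
        ≫ D.pl.map (D.dr X Y A).hom (𝟙 (D.tn.obj Z A))
      = (D.tn.map (𝟙 A) (D.aP X Y Z).hom ≫ (D.dl A (D.pl.obj X Y) Z).hom
        ≫ D.pl.map (D.dl A X Y).hom (𝟙 (D.tn.obj A Z)))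
        ≫ D.pl.map (D.pl.map (D.br A X).hom (D.br A Y).hom) (D.br A Z).hom := by
  rw [← Category.assoc, ← D.natBr, Category.assoc, ← Category.assoc (D.br A _).hom, ← hD6]
  simp only [Category.assoc]
  rw [Bifunc.map_comp_id, Bifunc.map_id_comp, hD6]

/-- Braiding carries the distribute-then-reassociate side of right compatibility to the left. -/
lemma br_comp_dr_aP (hD6 : diag6 D) (A X Y Z : C) :
    (D.br A _).hom ≫ (D.dr X (D.pl.obj Y Z) A).hom
        ≫ D.pl.map (𝟙 (D.tn.obj X A)) (D.dr Y Z A).hom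
        ≫ (D.aP (D.tn.obj X A) (D.tn.obj Y A) (D.tn.obj Z A)).hom
      = ((D.dl A X (D.pl.obj Y Z)).hom ≫ D.pl.map (𝟙 (D.tn.obj A X)) (D.dl A Y Z).hom
        ≫ (D.aP (D.tn.obj A X) (D.tn.obj A Y) (D.tn.obj A Z)).hom)
        ≫ D.pl.map (D.pl.map (D.br A X).hom (D.br A Y).hom) (D.br A Z).hom := by
  rw [← Category.assoc, ← hD6]
  simp only [Category.assoc]
  rw [← D.natAP, ← Category.assoc (D.pl.map (D.br A X).hom _), Bifunc.map_comp_id_left,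
    ← Category.assoc (D.pl.map (𝟙 _) _), Bifunc.map_id_comp_left, hD6]

end

/-- **Proposition 3.2.** In the axiomatics of a braided Ann-category, the compatibility of the
`⊕`-functor `(R^A, ℜ)` with the associativity constraint `a⁺` can be deduced from the
compatibility of `(L^A, 𝔏)` with `a⁺` together with diagram (6); and dually. -/
theorem stmt0 {C : Type u} [Category.{v} C] (D : Data C)
    (hPentP : pentP D) (hTriP : triP D) (hHexP : hexP D) (hSymP : symP D)
    (hGrpd : grpdP C) (hInv : invObjP D)
    (hPentT : pentT D) (hTriT : triT D)
    (hHex1 : hexT1 D) (hHex2 : hexT2 D)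
    (hCompLcP : compLcP D) (hCompRcP : compRcP D)
    (hD1 : diag1 D) (hD2 : diag2 D) (hD3 : diag3 D) (hD4 : diag4 D)
    (hD51 : diag51 D) (hD52 : diag52 D)
    (hD6 : diag6 D) (hC00 : c00 D) :
    (compLaP D → compRaP D) ∧ (compRaP D → compLaP D) := by
  constructor
  · intro h X Y Z A
    rw [← cancel_epi (D.br A _).hom, br_comp_map_aP_dr hD6, br_comp_dr_aP hD6, h]
  · intro h A X Y Z
    have := hGrpd (D.pl.map (D.pl.map (D.br A X).hom (D.br A Y).hom) (D.br A Z).hom)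
    rw [← cancel_mono (D.pl.map (D.pl.map (D.br A X).hom (D.br A Y).hom) (D.br A Z).hom),
      ← br_comp_map_aP_dr hD6, ← br_comp_dr_aP hD6, h]

end AnnCat
end

section
/- Let 𝒜 carry all the data of a braided Ann-category, and assume that diagram (5.1) and diagram (6) hold and that the braiding c is compatible with the unit constraint (1,l,r), i.e. r_A∘c_{1,A} = l_A (equivalently l_A∘c_{A,1} = r_A) for all A. Then diagram (5.2) commutes: (r_X⊕r_Y)∘ℜ_{X,Y,1} = r_{X⊕Y} for all X, Y. -/
open CategoryTheory

universe v u

namespace AnnCat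

/-- **Proposition 3.4.** In a braided Ann-category, the commutativity of diagram (5.2) can be
deduced from diagram (5.1), diagram (6) and the compatibility of the braiding `c` with the
unit constraint `(1, l, r)`. -/
theorem stmt2 {C : Type u} [Category.{v} C] (D : Data C)
    (hD51 : diag51 D) (hD6 : diag6 D) (hBrUnit : brUnit D) :
    diag52 D := by
  intro X Y
  rw [← cancel_epi (D.br D.one (D.pl.obj X Y)).hom, hBrUnit, ← hD51, ← Category.assoc, ← hD6,
    Category.assoc, ← D.pl.map_comp, hBrUnit, hBrUnit]

end AnnCat
end

section
/- In a braided Ann-category 𝒜, diagram (7) commutes: for every object A, R̂^A∘c_{A,0} = L̂^A as morphisms A⊗0 → 0, where L̂^A and R̂^A are the unique U-functor isomorphisms and c is the braiding. -/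
open CategoryTheory

universe v u

namespace AnnCat

/-- Morphisms that agree after applying `− ⊕ Z` are equal, provided `Z` is isomorphic to `0`. -/
theorem eq_of_pl_map_id_eq {C : Type u} [Category.{v} C] (D : Data C) {X Y Z : C}
    (e : Z ≅ D.zero) {f f' : X ⟶ Y} (h : D.pl.map f (𝟙 Z) = D.pl.map f' (𝟙 Z)) : f = f' := by
  have key : ∀ k : X ⟶ Y,
      D.pl.map k (𝟙 D.zero) = D.pl.map (𝟙 X) e.inv ≫ D.pl.map k (𝟙 Z) ≫ D.pl.map (𝟙 Y) e.hom := by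
    intro k
    simp [← D.pl.map_comp]
  have h0 : D.pl.map f (𝟙 D.zero) = D.pl.map f' (𝟙 D.zero) := by
    rw [key f, key f', h]
  rw [← cancel_epi (D.d X).hom, ← D.natD, ← D.natD, h0]

/-- Composing `R̂^A` with the braiding makes `(L^A, 𝔏)` compatible with the left unit constraint. -/
theorem br_comp_hatR_compatible {C : Type u} [Category.{v} C] (D : Data C) (h6 : diag6 D)
    (hatR : ∀ A : C, D.tn.obj D.zero A ≅ D.zero) (hUR : isUR D hatR) (A X : C) :
    (D.dl A D.zero X).hom ≫
        D.pl.map ((D.br A D.zero).hom ≫ (hatR A).hom) (𝟙 (D.tn.obj A X)) ≫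
        (D.g (D.tn.obj A X)).hom = D.tn.map (𝟙 A) (D.g X).hom := by
  have hsplit : D.pl.map ((D.br A D.zero).hom ≫ (hatR A).hom) (𝟙 (D.tn.obj A X)) ≫
      D.pl.map (𝟙 D.zero) (D.br A X).hom =
      D.pl.map (D.br A D.zero).hom (D.br A X).hom ≫
        D.pl.map (hatR A).hom (𝟙 (D.tn.obj X A)) := by
    simp [← D.pl.map_comp]
  rw [← cancel_mono (D.br A X).hom, D.natBr, ← (hUR A X).1, ← reassoc_of% (h6 A D.zero X)]
  simp only [Category.assoc]
  rw [← D.natG, reassoc_of% hsplit]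

/-- **Proposition 4.2.** In a braided Ann-category the diagram (7) commutes:
`R̂^A ∘ c_{A,0} = L̂^A : A ⊗ 0 → 0`, where `L̂^A`, `R̂^A` are the unique isomorphisms making
`(L^A, 𝔏, L̂^A)` and `(R^A, ℜ, R̂^A)` U-functors. -/
theorem stmt4 {C : Type u} [Category.{v} C] (D : Data C) (hB : IsBraidedAnn D)
    (hatL : ∀ A : C, D.tn.obj A D.zero ≅ D.zero)
    (hatR : ∀ A : C, D.tn.obj D.zero A ≅ D.zero)
    (hUL : isUL D hatL) (hUR : isUR D hatR) :
    ∀ A : C, (D.br A D.zero).hom ≫ (hatR A).hom = (hatL A).hom := by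
  intro A
  apply eq_of_pl_map_id_eq D (hatL A)
  have h := (br_comp_hatR_compatible D hB.hD6 hatR hUR A D.zero).trans (hUL A D.zero).1.symm
  rwa [cancel_epi, cancel_mono] at h

end AnnCat
end

section
/- Every symmetric Ann-category is a distributivity category: taking the null object O = 0, the same constraints a⁺, c⁺, g, d, a, c, l, r, 𝔏, ℜ, and L̂^A : A⊗0 → 0, R̂^A : 0⊗A → 0 the unique U-functor isomorphisms, all of Laplaza's axioms, in particular (L1)–(L13), are satisfied. -/
open CategoryTheory

universe v u

namespace AnnCat

variable {C : Type u} [Category.{v} C]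

/-- The data of a distributivity category: the data of a (braided) Ann-category together with
natural isomorphisms `L̂^A : A ⊗ O → O` and `R̂^A : O ⊗ A → O`. -/
structure DistData (C : Type u) [Category.{v} C] extends Data C where
  hatL : ∀ A : C, tn.obj A zero ≅ zero
  hatR : ∀ A : C, tn.obj zero A ≅ zero

/-! Laplaza's axioms (L1)-(L13). -/

def L1ax (E : DistData C) : Prop := (E.hatL E.zero).hom = (E.hatR E.zero).hom

def L2ax (E : DistData C) : Prop := ∀ A B : C,
  (E.hatR (E.pl.obj A B)).hom
    = (E.dl E.zero A B).hom ≫ E.pl.map (E.hatR A).hom (E.hatR B).hom ≫ (E.g E.zero).hom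

def L3ax (E : DistData C) : Prop := ∀ A B : C,
  (E.hatL (E.pl.obj A B)).hom
    = (E.dr A B E.zero).hom ≫ E.pl.map (E.hatL A).hom (E.hatL B).hom ≫ (E.d E.zero).hom

def L4ax (E : DistData C) : Prop := (E.hatL E.one).hom = (E.l E.zero).hom

def L5ax (E : DistData C) : Prop := (E.hatR E.one).hom = (E.r E.zero).hom

def L6ax (E : DistData C) : Prop := ∀ A : C,
  (E.hatL A).hom = (E.br A E.zero).hom ≫ (E.hatR A).hom

def L7ax (E : DistData C) : Prop := ∀ A B : C,
  (E.hatR (E.tn.obj A B)).hom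
    = (E.a E.zero A B).hom ≫ E.tn.map (E.hatR A).hom (𝟙 B) ≫ (E.hatR B).hom

def L8ax (E : DistData C) : Prop := ∀ A B : C,
  E.tn.map (𝟙 A) (E.hatR B).hom ≫ (E.hatL A).hom
    = (E.a A E.zero B).hom ≫ E.tn.map (E.hatL A).hom (𝟙 B) ≫ (E.hatR B).hom

def L9ax (E : DistData C) : Prop := ∀ A B : C,
  (E.a A B E.zero).hom ≫ (E.hatL (E.tn.obj A B)).hom
    = E.tn.map (𝟙 A) (E.hatL B).hom ≫ (E.hatL A).hom

def L10ax (E : DistData C) : Prop := ∀ A B : C,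
  (E.dl A E.zero B).hom ≫ E.pl.map (E.hatL A).hom (𝟙 (E.tn.obj A B))
      ≫ (E.g (E.tn.obj A B)).hom = E.tn.map (𝟙 A) (E.g B).hom

def L11ax (E : DistData C) : Prop := ∀ A B : C,
  (E.dr E.zero B A).hom ≫ E.pl.map (E.hatR A).hom (𝟙 (E.tn.obj B A))
      ≫ (E.g (E.tn.obj B A)).hom = E.tn.map (E.g B).hom (𝟙 A)

def L12ax (E : DistData C) : Prop := ∀ A B : C,
  (E.dl A B E.zero).hom ≫ E.pl.map (𝟙 (E.tn.obj A B)) (E.hatL A).hom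
      ≫ (E.d (E.tn.obj A B)).hom = E.tn.map (𝟙 A) (E.d B).hom

def L13ax (E : DistData C) : Prop := ∀ A B : C,
  (E.dr A E.zero B).hom ≫ E.pl.map (𝟙 (E.tn.obj A B)) (E.hatR B).hom
      ≫ (E.d (E.tn.obj A B)).hom = E.tn.map (E.d A).hom (𝟙 B)

/-- The axioms of a distributivity category other than (L1)-(L13): both symmetric monoidal
structures are coherent, `(L^A, 𝔏)` and `(R^A, ℜ)` are `⊕`-functors compatible with `a⁺`, `c⁺`,
`L̂`, `R̂` are natural, and the diagrams (1)-(4), (5.1), (5.2), (6) commute. -/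
structure DistCore (E : DistData C) : Prop where
  hPentP : pentP E.toData
  hTriP : triP E.toData
  hHexP : hexP E.toData
  hSymP : symP E.toData
  hPentT : pentT E.toData
  hTriT : triT E.toData
  hHexT1 : hexT1 E.toData
  hHexT2 : hexT2 E.toData
  hSymT : symT E.toData
  hNatHatL : ∀ {A A' : C} (f : A ⟶ A'),
      E.tn.map f (𝟙 E.zero) ≫ (E.hatL A').hom = (E.hatL A).hom
  hNatHatR : ∀ {A A' : C} (f : A ⟶ A'),
      E.tn.map (𝟙 E.zero) f ≫ (E.hatR A').hom = (E.hatR A).hom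
  hCompLaP : compLaP E.toData
  hCompLcP : compLcP E.toData
  hCompRaP : compRaP E.toData
  hCompRcP : compRcP E.toData
  hD1 : diag1 E.toData
  hD2 : diag2 E.toData
  hD3 : diag3 E.toData
  hD4 : diag4 E.toData
  hD51 : diag51 E.toData
  hD52 : diag52 E.toData
  hD6 : diag6 E.toData

/-- A distributivity category in the sense of Laplaza. -/
structure IsDistCat (E : DistData C) extends DistCore E : Prop where
  hL1 : L1ax E
  hL2 : L2ax E
  hL3 : L3ax E
  hL4 : L4ax E
  hL5 : L5ax E
  hL6 : L6ax E
  hL7 : L7ax E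
  hL8 : L8ax E
  hL9 : L9ax E
  hL10 : L10ax E
  hL11 : L11ax E
  hL12 : L12ax E
  hL13 : L13ax E

/-- The Fröhlich–Wall diagram (8). -/
def diag8 (D : Data C) : Prop := ∀ A B X Y : C,
  (D.dl (D.pl.obj X Y) A B).hom
      ≫ D.pl.map (D.br (D.pl.obj X Y) A).hom (D.br (D.pl.obj X Y) B).hom
      ≫ D.pl.map (D.dl A X Y).hom (D.dl B X Y).hom
      ≫ v D (D.tn.obj A X) (D.tn.obj A Y) (D.tn.obj B X) (D.tn.obj B Y)
      ≫ D.pl.map (D.pl.map (D.br A X).hom (D.br B X).hom)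
          (D.pl.map (D.br A Y).hom (D.br B Y).hom)
    = (D.br (D.pl.obj X Y) (D.pl.obj A B)).hom ≫ (D.dl (D.pl.obj A B) X Y).hom
      ≫ D.pl.map (D.br (D.pl.obj A B) X).hom (D.br (D.pl.obj A B) Y).hom
      ≫ D.pl.map (D.dl X A B).hom (D.dl Y A B).hom

/-- A ring-like category in the sense of Fröhlich and Wall: two coherent symmetric monoidal
structures `(𝒜,⊕,a⁺,c⁺)`, `(𝒜,⊗,a,c)`, a natural left distributivity isomorphism `𝔏` such that
each `(L^A, 𝔏)` is a `⊕`-functor compatible with `a⁺` and `c⁺` and diagrams (1) and (8) hold. -/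
structure IsRingLike (D : Data C) : Prop where
  hPentP : pentP D
  hTriP : triP D
  hHexP : hexP D
  hSymP : symP D
  hPentT : pentT D
  hTriT : triT D
  hHexT1 : hexT1 D
  hHexT2 : hexT2 D
  hSymT : symT D
  hCompLaP : compLaP D
  hCompLcP : compLcP D
  hD1 : diag1 D
  hD8 : diag8 D

/-- The right distributivity constraint is the one induced from `𝔏` and the braiding via
diagram (6): `ℜ_{X,Y,A} = (c_{A,X} ⊕ c_{A,Y}) ∘ 𝔏_{A,X,Y} ∘ c_{A,X⊕Y}⁻¹`. -/
def drFormula (D : Data C) : Prop := ∀ X Y A : C,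
  (D.dr X Y A).hom
    = (D.br A (D.pl.obj X Y)).inv ≫ (D.dl A X Y).hom
      ≫ D.pl.map (D.br A X).hom (D.br A Y).hom

end AnnCat

namespace AnnCat

section Cancellation

open MonoidalCategory

/-- Whiskering with an object that has a right inverse is faithful. -/
theorem whiskerRight_cancel {C : Type u} [Category.{v} C] [MonoidalCategory C] {X X' Y Z : C}
    (e : X ⊗ X' ≅ 𝟙_ C) {f f' : Y ⟶ Z} (h : f ▷ X = f' ▷ X) : f = f' := by
  have key : f ▷ (X ⊗ X') = f' ▷ (X ⊗ X') := by
    rw [whiskerRight_tensor, whiskerRight_tensor, h]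
  rw [← whiskerRight_iff, ← cancel_epi (Y ◁ e.hom), whisker_exchange, whisker_exchange, key]

end Cancellation

section UnitConstraints

variable {C : Type u} [Category.{v} C] {D : Data C}

namespace Bifunc

variable (F : Bifunc C)

theorem comp_map {A B X Y A' X' : C} (f : A ⟶ B) (g : X ⟶ Y) (f' : B ⟶ A') (g' : Y ⟶ X') :
    F.map f g ≫ F.map f' g' = F.map (f ≫ f') (g ≫ g') := (F.map_comp ..).symm

theorem comp_map_assoc {A B X Y A' X' W : C} (f : A ⟶ B) (g : X ⟶ Y) (f' : B ⟶ A') (g' : Y ⟶ X')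
    (k : F.obj A' X' ⟶ W) :
    F.map f g ≫ F.map f' g' ≫ k = F.map (f ≫ f') (g ≫ g') ≫ k := by
  rw [← Category.assoc, comp_map]

end Bifunc

/-- The monoidal category `(𝒜, ⊕, a⁺, (0, g, d))`. -/
abbrev additiveMonoidal (D : Data C) (hPent : pentP D) (hTri : triP D) : MonoidalCategory C :=
  letI : MonoidalCategoryStruct C :=
    { tensorObj := D.pl.obj
      whiskerLeft := fun X _ _ f => D.pl.map (𝟙 X) f
      whiskerRight := fun f X => D.pl.map f (𝟙 X)
      tensorHom := D.pl.map
      tensorUnit := D.zero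
      associator := fun X Y Z => (D.aP X Y Z).symm
      leftUnitor := D.g
      rightUnitor := D.d }
  MonoidalCategory.ofTensorHom
    (id_tensorHom_id := D.pl.map_id)
    (id_tensorHom := fun _ _ _ _ => rfl)
    (tensorHom_id := fun _ _ => rfl)
    (tensorHom_comp_tensorHom := fun _ _ _ _ => D.pl.comp_map ..)
    (associator_naturality := fun f g h => by
      change D.pl.map (D.pl.map f g) h ≫ (D.aP ..).inv = (D.aP ..).inv ≫ D.pl.map f (D.pl.map g h)
      rw [Iso.comp_inv_eq, Category.assoc, Iso.eq_inv_comp, D.natAP])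
    (leftUnitor_naturality := D.natG)
    (rightUnitor_naturality := D.natD)
    (pentagon := fun W X Y Z => by
      change D.pl.map (D.aP ..).inv (𝟙 Z) ≫ (D.aP ..).inv ≫ D.pl.map (𝟙 W) (D.aP ..).inv
        = (D.aP ..).inv ≫ (D.aP ..).inv
      rw [← cancel_epi ((D.aP W X (D.pl.obj Y Z)).hom ≫ (D.aP (D.pl.obj W X) Y Z).hom)]
      nth_rw 1 [← hPent W X Y Z]
      simp only [Category.assoc, D.pl.comp_map_assoc, D.pl.comp_map, Iso.hom_inv_id,
        Iso.hom_inv_id_assoc, Category.id_comp, D.pl.map_id])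
    (triangle := fun X Y => by
      change (D.aP ..).inv ≫ D.pl.map (𝟙 X) (D.g Y).hom = D.pl.map (D.d X).hom (𝟙 Y)
      rw [← hTri X Y, Iso.inv_hom_id_assoc])

/-- The symmetric monoidal structure `(𝒜, ⊕, a⁺, c⁺, (0, g, d))` as a braiding. -/
abbrev additiveBraided (D : Data C) (hPent : pentP D) (hTri : triP D) (hHex : hexP D)
    (hSym : symP D) : @BraidedCategory C _ (additiveMonoidal D hPent hTri) :=
  let _ := additiveMonoidal D hPent hTri
  { braiding := D.cP
    braiding_naturality_right := fun _ _ _ _ => D.natCP ..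
    braiding_naturality_left := fun _ _ => D.natCP ..
    hexagon_forward := hHex
    hexagon_reverse := fun X Y Z => by
      change (D.aP X Y Z).hom ≫ (D.cP (D.pl.obj X Y) Z).hom ≫ (D.aP Z X Y).hom
        = D.pl.map (𝟙 X) (D.cP Y Z).hom ≫ (D.aP X Z Y).hom ≫ D.pl.map (D.cP X Z).hom (𝟙 Y)
      have hSym' : ∀ A B {W : C} (k : D.pl.obj A B ⟶ W),
          (D.cP A B).hom ≫ (D.cP B A).hom ≫ k = k := fun A B _ k => by
        rw [← Category.assoc, hSym A B, Category.id_comp]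
      rw [← cancel_epi ((D.aP Z X Y).inv ≫ (D.cP Z (D.pl.obj X Y)).hom ≫ (D.aP X Y Z).inv)]
      nth_rw 2 [hHex Z X Y]
      simp only [Category.assoc, D.pl.comp_map_assoc, D.pl.comp_map, Iso.inv_hom_id,
        Iso.inv_hom_id_assoc, Category.id_comp, D.pl.map_id, hSym', hSym _ _] }

namespace IsAnn

theorem zero_unitors_eq (h : IsAnn D) : (D.d D.zero).hom = (D.g D.zero).hom :=
  let _ := additiveMonoidal D h.hPentP h.hTriP
  (MonoidalCategory.unitors_equal (C := C)).symm

theorem aP_comp_g (h : IsAnn D) (X Y : C) :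
    (D.aP D.zero X Y).hom ≫ D.pl.map (D.g X).hom (𝟙 Y) = (D.g (D.pl.obj X Y)).hom := by
  let _ := additiveMonoidal D h.hPentP h.hTriP
  exact (MonoidalCategory.leftUnitor_tensor_hom X Y).symm

theorem cP_comp_g (h : IsAnn D) (X : C) : (D.cP X D.zero).hom ≫ (D.g X).hom = (D.d X).hom :=
  let _ := additiveMonoidal D h.hPentP h.hTriP
  let _ := additiveBraided D h.hPentP h.hTriP h.hHexP h.hSymP
  braiding_leftUnitor X

theorem pl_map_id_cancel (h : IsAnn D) {X Y Z : C} {f f' : Y ⟶ Z}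
    (e : D.pl.map f (𝟙 X) = D.pl.map f' (𝟙 X)) : f = f' := by
  let _ := additiveMonoidal D h.hPentP h.hTriP
  obtain ⟨X', ⟨i⟩⟩ := h.hInv X
  exact whiskerRight_cancel (X := X) (X' := X') i e

/-- A morphism into `0` is determined by its use in a unit compatibility square. -/
theorem hom_zero_ext (h : IsAnn D) {X T U W : C} (e : T ≅ D.pl.obj U X) (m : X ≅ W)
    {w w' : U ⟶ D.zero}
    (hw : e.hom ≫ D.pl.map w m.hom ≫ (D.g W).hom = e.hom ≫ D.pl.map w' m.hom ≫ (D.g W).hom) :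
    w = w' := by
  rw [cancel_epi, cancel_mono] at hw
  apply h.pl_map_id_cancel (X := X)
  have := congrArg (· ≫ D.pl.map (𝟙 _) m.inv) hw
  simpa only [D.pl.comp_map, Category.comp_id, Iso.hom_inv_id] using this

/-- The middle four interchange is compatible with the left unit constraint. -/
theorem v_comp_g (h : IsAnn D) (P Q : C) :
    v D D.zero P D.zero Q ≫ D.pl.map (D.g D.zero).hom (𝟙 (D.pl.obj P Q))
        ≫ (D.g (D.pl.obj P Q)).hom
      = D.pl.map (D.g P).hom (D.g Q).hom := by
  have hTri := h.hTriP D.zero (D.pl.obj P Q)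
  rw [h.zero_unitors_eq] at hTri
  rw [v, Category.assoc, Category.assoc, ← Category.assoc (D.aP D.zero D.zero _).hom, hTri,
    D.natG, ← Category.assoc (D.pl.map _ _), D.natG]
  simp only [Category.assoc]
  rw [Iso.inv_comp_eq]
  rw [← h.aP_comp_g P Q, Iso.inv_hom_id_assoc, D.pl.comp_map, h.cP_comp_g, Category.comp_id,
    h.hTriP, ← h.aP_comp_g P]
  simp only [Category.assoc, D.pl.comp_map, Category.comp_id, Category.id_comp]

theorem v_naturality (D : Data C) {U U' V V' Z Z' T T' : C} (f : U ⟶ U') (k : V ⟶ V')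
    (m : Z ⟶ Z') (n : T ⟶ T') :
    v D U V Z T ≫ D.pl.map (D.pl.map f m) (D.pl.map k n)
      = D.pl.map (D.pl.map f k) (D.pl.map m n) ≫ v D U' V' Z' T' := by
  have natInv : ∀ {A A' B B' X X' : C} (f : A ⟶ A') (h : B ⟶ B') (k : X ⟶ X'),
      D.pl.map (D.pl.map f h) k ≫ (D.aP A' B' X').inv
        = (D.aP A B X).inv ≫ D.pl.map f (D.pl.map h k) := fun f h k => by
    rw [Iso.comp_inv_eq, Category.assoc, D.natAP, Iso.inv_hom_id_assoc]
  have inner : D.pl.map k (D.pl.map m n) ≫ ((D.aP V' Z' T').hom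
        ≫ D.pl.map (D.cP V' Z').hom (𝟙 T') ≫ (D.aP Z' V' T').inv)
      = ((D.aP V Z T).hom ≫ D.pl.map (D.cP V Z).hom (𝟙 T) ≫ (D.aP Z V T).inv)
        ≫ D.pl.map m (D.pl.map k n) := by
    simp only [Category.assoc]
    rw [← natInv, ← Category.assoc (D.pl.map _ _), D.natAP, Category.assoc,
      D.pl.comp_map_assoc, D.pl.comp_map_assoc, D.natCP, Category.comp_id, Category.id_comp]
  simp only [v]
  rw [← Category.assoc (D.pl.map (D.pl.map f k) _), natInv]
  simp only [Category.assoc]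
  rw [← D.natAP, D.pl.comp_map_assoc, D.pl.comp_map_assoc, inner, Category.comp_id,
    Category.id_comp]

end IsAnn

/-! Laplaza's axioms for the unit isomorphisms of the distributivity functors. -/

section Unit

variable {hatL : ∀ A : C, D.tn.obj A D.zero ≅ D.zero}
  {hatR : ∀ A : C, D.tn.obj D.zero A ≅ D.zero}

theorem isUL.hom_ext (h : IsAnn D) (hUL : isUL D hatL) {A X W : C}
    {w : D.tn.obj A D.zero ⟶ D.zero} (m : D.tn.obj A X ≅ W)
    (hw : (D.dl A D.zero X).hom ≫ D.pl.map w m.hom ≫ (D.g W).hom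
      = D.tn.map (𝟙 A) (D.g X).hom ≫ m.hom) : w = (hatL A).hom := by
  refine h.hom_zero_ext (D.dl A D.zero X) m (hw.trans ?_)
  rw [← (hUL A X).1, Category.assoc, Category.assoc, ← D.natG, D.pl.comp_map_assoc,
    Category.comp_id, Category.id_comp]

theorem isUR.hom_ext (h : IsAnn D) (hUR : isUR D hatR) {A X W : C}
    {w : D.tn.obj D.zero A ⟶ D.zero} (m : D.tn.obj X A ≅ W)
    (hw : (D.dr D.zero X A).hom ≫ D.pl.map w m.hom ≫ (D.g W).hom
      = D.tn.map (D.g X).hom (𝟙 A) ≫ m.hom) : w = (hatR A).hom := by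
  refine h.hom_zero_ext (D.dr D.zero X A) m (hw.trans ?_)
  rw [← (hUR A X).1, Category.assoc, Category.assoc, ← D.natG, D.pl.comp_map_assoc,
    Category.comp_id, Category.id_comp]

theorem hatL_eq_br_comp_hatR (h : IsBraidedAnn D) (hUL : isUL D hatL) (hUR : isUR D hatR) (A : C) :
    (hatL A).hom = (D.br A D.zero).hom ≫ (hatR A).hom := by
  refine (hUL.hom_ext h.toIsAnn (D.br A D.zero) ?_).symm
  have e : D.pl.map ((D.br A D.zero).hom ≫ (hatR A).hom) (D.br A D.zero).hom
      = D.pl.map (D.br A D.zero).hom (D.br A D.zero).hom ≫ D.pl.map (hatR A).hom (𝟙 _) := by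
    rw [D.pl.comp_map, Category.comp_id]
  rw [e, Category.assoc, ← Category.assoc, h.hD6, Category.assoc, (hUR A D.zero).1, D.natBr]

theorem hatL_natural (h : IsAnn D) (hUL : isUL D hatL) {A A' : C} (f : A ⟶ A') :
    D.tn.map f (𝟙 D.zero) ≫ (hatL A').hom = (hatL A).hom := by
  have := h.hGrpd (D.tn.map f (𝟙 D.zero))
  refine hUL.hom_ext h (asIso (D.tn.map f (𝟙 D.zero))) ?_
  have e : D.pl.map (D.tn.map f (𝟙 D.zero) ≫ (hatL A').hom) (D.tn.map f (𝟙 D.zero))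
      = D.pl.map (D.tn.map f (𝟙 D.zero)) (D.tn.map f (𝟙 D.zero))
        ≫ D.pl.map (hatL A').hom (𝟙 _) := by
    rw [D.pl.comp_map, Category.comp_id]
  rw [asIso_hom, e, Category.assoc, ← Category.assoc, ← D.natDL, Category.assoc, (hUL A' D.zero).1,
    D.tn.comp_map, D.tn.comp_map, D.pl.map_id, Category.id_comp, Category.comp_id,
    Category.id_comp, Category.comp_id]

theorem hatR_natural (h : IsAnn D) (hUR : isUR D hatR) {A A' : C} (f : A ⟶ A') :
    D.tn.map (𝟙 D.zero) f ≫ (hatR A').hom = (hatR A).hom := by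
  have := h.hGrpd (D.tn.map (𝟙 D.zero) f)
  refine hUR.hom_ext h (asIso (D.tn.map (𝟙 D.zero) f)) ?_
  have e : D.pl.map (D.tn.map (𝟙 D.zero) f ≫ (hatR A').hom) (D.tn.map (𝟙 D.zero) f)
      = D.pl.map (D.tn.map (𝟙 D.zero) f) (D.tn.map (𝟙 D.zero) f)
        ≫ D.pl.map (hatR A').hom (𝟙 _) := by
    rw [D.pl.comp_map, Category.comp_id]
  rw [asIso_hom, e, Category.assoc, ← Category.assoc, ← D.natDR, Category.assoc, (hUR A' D.zero).1,
    D.tn.comp_map, D.tn.comp_map, D.pl.map_id, Category.id_comp, Category.comp_id,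
    Category.id_comp, Category.comp_id]

theorem hatR_add (h : IsAnn D) (hUR : isUR D hatR) (A B : C) :
    (hatR (D.pl.obj A B)).hom
      = (D.dl D.zero A B).hom ≫ D.pl.map (hatR A).hom (hatR B).hom ≫ (D.g D.zero).hom := by
  refine (hUR.hom_ext h (D.dl D.zero A B) ?_).symm
  have e : D.pl.map ((D.dl D.zero A B).hom ≫ D.pl.map (hatR A).hom (hatR B).hom
          ≫ (D.g D.zero).hom) (D.dl D.zero A B).hom
      = D.pl.map (D.dl D.zero A B).hom (D.dl D.zero A B).hom
        ≫ D.pl.map (D.pl.map (hatR A).hom (hatR B).hom) (D.pl.map (𝟙 _) (𝟙 _))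
        ≫ D.pl.map (D.g D.zero).hom (𝟙 _) := by
    simp only [D.pl.comp_map, D.pl.map_id, Category.comp_id]
  rw [e, Category.assoc, ← Category.assoc, ← h.hD4]
  simp only [Category.assoc]
  rw [← Category.assoc (v D _ _ _ _), IsAnn.v_naturality, Category.assoc, h.v_comp_g,
    D.pl.comp_map, D.pl.comp_map, (hUR A D.zero).1, (hUR B D.zero).1, ← D.natDL, D.pl.map_id]

theorem hatL_add (h : IsBraidedAnn D) (hSym : symT D) (hUL : isUL D hatL) (hUR : isUR D hatR)
    (A B : C) :
    (hatL (D.pl.obj A B)).hom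
      = (D.dr A B D.zero).hom ≫ D.pl.map (hatL A).hom (hatL B).hom ≫ (D.d D.zero).hom := by
  have hR : ∀ A, (hatR A).hom = (D.br D.zero A).hom ≫ (hatL A).hom := fun A => by
    rw [hatL_eq_br_comp_hatR h hUL hUR, ← Category.assoc, hSym, Category.id_comp]
  rw [hatL_eq_br_comp_hatR h hUL hUR, hatR_add h.toIsAnn hUR, hR A, hR B, D.pl.map_comp,
    Category.assoc, ← Category.assoc (D.dl _ _ _).hom, h.hD6]
  simp only [← Category.assoc]
  rw [hSym, Category.id_comp, h.zero_unitors_eq]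

theorem hatL_one (h : IsAnn D) (hUL : isUL D hatL) : (hatL D.one).hom = (D.l D.zero).hom := by
  refine (hUL.hom_ext h (D.l D.zero) ?_).symm
  rw [← Category.assoc, h.hD51, D.natL]

theorem hatR_one (h : IsAnn D) (hUR : isUR D hatR) : (hatR D.one).hom = (D.r D.zero).hom := by
  refine (hUR.hom_ext h (D.r D.zero) ?_).symm
  rw [← Category.assoc, h.hD52, D.natR]

theorem hatR_mul (h : IsAnn D) (hUR : isUR D hatR) (A B : C) :
    (hatR (D.tn.obj A B)).hom
      = (D.a D.zero A B).hom ≫ D.tn.map (hatR A).hom (𝟙 B) ≫ (hatR B).hom := by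
  refine (hUR.hom_ext h (D.a D.zero A B) ?_).symm
  have e : D.pl.map ((D.a D.zero A B).hom ≫ D.tn.map (hatR A).hom (𝟙 B) ≫ (hatR B).hom)
        (D.a D.zero A B).hom
      = D.pl.map (D.a D.zero A B).hom (D.a D.zero A B).hom
        ≫ D.pl.map (D.tn.map (hatR A).hom (𝟙 B)) (D.tn.map (𝟙 _) (𝟙 B))
        ≫ D.pl.map (hatR B).hom (𝟙 _) := by
    simp only [D.pl.comp_map, D.tn.map_id, Category.comp_id]
  rw [e, Category.assoc, ← Category.assoc, ← h.hD2]
  simp only [Category.assoc]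
  rw [← Category.assoc (D.dr _ _ B).hom, ← D.natDR, Category.assoc, (hUR B _).1,
    D.tn.comp_map, D.tn.comp_map, (hUR A _).1, Category.comp_id, Category.comp_id, ← D.natA,
    D.tn.map_id]

theorem hatL_mul (h : IsAnn D) (hUL : isUL D hatL) (A B : C) :
    (D.a A B D.zero).hom ≫ (hatL (D.tn.obj A B)).hom
      = D.tn.map (𝟙 A) (hatL B).hom ≫ (hatL A).hom := by
  rw [← Iso.eq_inv_comp]
  refine (hUL.hom_ext h (D.a A B D.zero).symm ?_).symm
  rw [← cancel_epi (D.a A B (D.pl.obj D.zero D.zero)).hom, ← Category.assoc, h.hD1]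
  simp only [Category.assoc, D.pl.comp_map_assoc, Iso.symm_hom, Iso.hom_inv_id,
    Iso.hom_inv_id_assoc]
  have e : D.pl.map (D.tn.map (𝟙 A) (hatL B).hom ≫ (hatL A).hom) (𝟙 _)
      = D.pl.map (D.tn.map (𝟙 A) (hatL B).hom) (D.tn.map (𝟙 A) (𝟙 (D.tn.obj B D.zero)))
        ≫ D.pl.map (hatL A).hom (𝟙 _) := by
    simp only [D.pl.comp_map, D.tn.map_id, Category.comp_id]
  rw [e, Category.assoc, ← Category.assoc (D.dl A _ _).hom, ← D.natDL, Category.assoc, (hUL A _).1,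
    D.tn.comp_map, D.tn.comp_map, (hUL B _).1, Category.comp_id, Category.comp_id,
    ← Category.assoc, Iso.eq_comp_inv, D.natA, D.tn.map_id]

theorem hatR_hatL_comm (h : IsAnn D) (hUL : isUL D hatL) (hUR : isUR D hatR) (A B : C) :
    D.tn.map (𝟙 A) (hatR B).hom ≫ (hatL A).hom
      = (D.a A D.zero B).hom ≫ D.tn.map (hatL A).hom (𝟙 B) ≫ (hatR B).hom := by
  have := h.hGrpd (D.tn.map (𝟙 A) (D.dr D.zero D.zero B).hom)
  refine h.hom_zero_ext (asIso (D.tn.map (𝟙 A) (D.dr D.zero D.zero B).hom) ≪≫ D.dl A _ _)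
    (D.a A D.zero B) ?_
  have e₁ : D.pl.map (D.tn.map (𝟙 A) (hatR B).hom ≫ (hatL A).hom) (D.a A D.zero B).hom
      = D.pl.map (D.tn.map (𝟙 A) (hatR B).hom) (D.tn.map (𝟙 A) (𝟙 (D.tn.obj D.zero B)))
        ≫ D.pl.map (hatL A).hom (𝟙 _) ≫ D.pl.map (𝟙 D.zero) (D.a A D.zero B).hom := by
    simp only [D.pl.comp_map, D.tn.map_id, Category.comp_id, Category.id_comp]
  have e₂ : D.pl.map ((D.a A D.zero B).hom ≫ D.tn.map (hatL A).hom (𝟙 B) ≫ (hatR B).hom)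
        (D.a A D.zero B).hom
      = D.pl.map (D.a A D.zero B).hom (D.a A D.zero B).hom
        ≫ D.pl.map (D.tn.map (hatL A).hom (𝟙 B)) (D.tn.map (𝟙 _) (𝟙 B))
        ≫ D.pl.map (hatR B).hom (𝟙 _) := by
    simp only [D.pl.comp_map, D.tn.map_id, Category.comp_id]
  have lhs : D.tn.map (𝟙 A) (D.dr D.zero D.zero B).hom ≫ (D.dl A _ _).hom
        ≫ D.pl.map (D.tn.map (𝟙 A) (hatR B).hom ≫ (hatL A).hom) (D.a A D.zero B).hom
        ≫ (D.g _).hom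
      = D.tn.map (𝟙 A) (D.tn.map (D.g D.zero).hom (𝟙 B)) ≫ (D.a A D.zero B).hom := by
    simp only [e₁, Category.assoc]
    rw [D.natG, ← Category.assoc (D.dl A _ _).hom, ← D.natDL]
    simp only [Category.assoc]
    rw [← Category.assoc (D.pl.map (hatL A).hom _), ← Category.assoc (D.dl A _ _).hom,
      (hUL A (D.tn.obj D.zero B)).1, D.tn.comp_map_assoc, D.tn.comp_map_assoc,
      Category.assoc (D.dr _ _ B).hom, (hUR B D.zero).1, Category.comp_id, Category.comp_id]
  have rhs : D.tn.map (𝟙 A) (D.dr D.zero D.zero B).hom ≫ (D.dl A _ _).hom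
        ≫ D.pl.map ((D.a A D.zero B).hom ≫ D.tn.map (hatL A).hom (𝟙 B) ≫ (hatR B).hom)
          (D.a A D.zero B).hom ≫ (D.g _).hom
      = D.tn.map (𝟙 A) (D.tn.map (D.g D.zero).hom (𝟙 B)) ≫ (D.a A D.zero B).hom := by
    rw [e₂]
    simp only [Category.assoc]
    rw [← Category.assoc (D.dl A _ _).hom, ← Category.assoc (D.tn.map _ _), ← h.hD3]
    simp only [Category.assoc]
    rw [← Category.assoc (D.dr _ _ B).hom, ← D.natDR, Category.assoc, (hUR B _).1,
      D.tn.comp_map, D.tn.comp_map, (hUL A _).1, Category.comp_id, Category.comp_id, D.natA]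
  simp only [Iso.trans_hom, asIso_hom, Category.assoc]
  exact lhs.trans rhs.symm

end Unit

end UnitConstraints

/-- **Proposition 5.1.** Every symmetric Ann-category is a distributivity category: with the
same constraints and with `L̂^A`, `R̂^A` the unique U-functor isomorphisms, all of Laplaza's
axioms, in particular (L1)-(L13), are satisfied. -/
theorem stmt5 {C : Type u} [Category.{v} C] (D : Data C) (hS : IsSymAnn D)
    (hatL : ∀ A : C, D.tn.obj A D.zero ≅ D.zero)
    (hatR : ∀ A : C, D.tn.obj D.zero A ≅ D.zero)
    (hUL : isUL D hatL) (hUR : isUR D hatR) :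
    IsDistCat { toData := D, hatL := hatL, hatR := hatR } := by
  have h := hS.1.toIsAnn
  exact
    { h, hS.1 with
      hHexT1 := hS.1.hHex1
      hHexT2 := hS.1.hHex2
      hSymT := hS.2
      hNatHatL := hatL_natural h hUL
      hNatHatR := hatR_natural h hUR
      hL1 := by
        have e := hatL_eq_br_comp_hatR hS.1 hUL hUR D.zero
        rwa [hS.1.hC00, Category.id_comp] at e
      hL2 := hatR_add h hUR
      hL3 := hatL_add hS.1 hS.2 hUL hUR
      hL4 := hatL_one h hUL
      hL5 := hatR_one h hUR
      hL6 := hatL_eq_br_comp_hatR hS.1 hUL hUR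
      hL7 := hatR_mul h hUR
      hL8 := hatR_hatL_comm h hUL hUR
      hL9 := hatL_mul h hUL
      hL10 := fun A B => (hUL A B).1
      hL11 := fun A B => (hUR A B).1
      hL12 := fun A B => (hUL A B).2
      hL13 := fun A B => (hUR B A).2 }

end AnnCat
end

section
/- A category 𝒜 equipped with bifunctors ⊕, ⊗ and constraint isomorphisms is a symmetric Ann-category if and only if: (i) it is a distributivity category, and (ii) every object of (𝒜,⊕) is invertible with respect to ⊕ and the underlying category of (𝒜,⊕) is a groupoid. -/
open CategoryTheory

universe v u

namespace AnnCat

section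

variable {C : Type u} [Category.{v} C]

theorem Bifunc.map_comp_assoc (T : Bifunc C) {A B E X Y Z : C} (f : A ⟶ B) (g : B ⟶ E) (h : X ⟶ Y)
    (k : Y ⟶ Z) {W : C} (w : T.obj E Z ⟶ W) :
    T.map (f ≫ g) (h ≫ k) ≫ w = T.map f h ≫ T.map g k ≫ w := by
  rw [T.map_comp, Category.assoc]

instance Bifunc.isIso_map (T : Bifunc C) {A B X Y : C} (f : A ⟶ B) (k : X ⟶ Y) [IsIso f]
    [IsIso k] : IsIso (T.map f k) :=
  ⟨T.map (inv f) (inv k), by simp [← T.map_comp, T.map_id], by simp [← T.map_comp, T.map_id]⟩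

/-- The monoidal structure on `C` given by `⊕`. -/
abbrev addMonoidal (D : Data C) (hP : pentP D) (hT : triP D) : MonoidalCategory C :=
  letI : MonoidalCategoryStruct C :=
    { tensorObj := D.pl.obj
      whiskerLeft := fun X _ _ f => D.pl.map (𝟙 X) f
      whiskerRight := fun f X => D.pl.map f (𝟙 X)
      tensorHom := fun f k => D.pl.map f k
      tensorUnit := D.zero
      associator := fun A B X => (D.aP A B X).symm
      leftUnitor := D.g
      rightUnitor := D.d }
  MonoidalCategory.ofTensorHom
    (id_tensorHom_id := D.pl.map_id)
    (tensorHom_comp_tensorHom := fun f k f' k' => (D.pl.map_comp f f' k k').symm)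
    (associator_naturality := fun {X₁ X₂ X₃ Y₁ Y₂ Y₃} f₁ f₂ f₃ => by
      change D.pl.map (D.pl.map f₁ f₂) f₃ ≫ (D.aP Y₁ Y₂ Y₃).inv
        = (D.aP X₁ X₂ X₃).inv ≫ D.pl.map f₁ (D.pl.map f₂ f₃)
      rw [Iso.comp_inv_eq, Category.assoc, D.natAP, Iso.inv_hom_id_assoc])
    (leftUnitor_naturality := fun f => D.natG f)
    (rightUnitor_naturality := fun f => D.natD f)
    (pentagon := fun W X Y Z => by
      change D.pl.map (D.aP W X Y).inv (𝟙 Z) ≫ (D.aP W (D.pl.obj X Y) Z).inv ≫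
        D.pl.map (𝟙 W) (D.aP X Y Z).inv
          = (D.aP (D.pl.obj W X) Y Z).inv ≫ (D.aP W X (D.pl.obj Y Z)).inv
      have h := hP W X Y Z
      rw [← cancel_mono ((D.aP W X (D.pl.obj Y Z)).hom ≫ (D.aP (D.pl.obj W X) Y Z).hom)]
      conv_lhs => rw [← h]
      simp only [Category.assoc, ← D.pl.map_comp_assoc, Iso.inv_hom_id, Iso.inv_hom_id_assoc,
        Category.id_comp, Category.comp_id, D.pl.map_id, ← D.pl.map_comp])
    (triangle := fun X Y => by
      change (D.aP X D.zero Y).inv ≫ D.pl.map (𝟙 X) (D.g Y).hom = D.pl.map (D.d X).hom (𝟙 Y)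
      rw [← hT, Iso.inv_hom_id_assoc])

/-- The symmetry of the monoidal structure on `C` given by `⊕`. -/
abbrev addSymmetric (D : Data C) (hP : pentP D) (hT : triP D) (hH : hexP D) (hS : symP D) :
    letI := addMonoidal D hP hT
    SymmetricCategory C :=
  letI := addMonoidal D hP hT
  { braiding := D.cP
    braiding_naturality_right := fun X _ _ f => D.natCP (𝟙 X) f
    braiding_naturality_left := fun f Z => D.natCP f (𝟙 Z)
    hexagon_forward := hH
    hexagon_reverse := fun X Y Z => by
      change (D.aP X Y Z).hom ≫ (D.cP (D.pl.obj X Y) Z).hom ≫ (D.aP Z X Y).hom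
        = D.pl.map (𝟙 X) (D.cP Y Z).hom ≫ (D.aP X Z Y).hom ≫ D.pl.map (D.cP X Z).hom (𝟙 Y)
      have h := hH Z X Y
      have hc : ∀ A B : C, (D.cP A B).hom = (D.cP B A).inv := fun A B => by
        rw [← cancel_mono (D.cP B A).hom, hS, Iso.inv_hom_id]
      rw [← cancel_mono ((D.aP Z X Y).inv ≫ (D.cP Z (D.pl.obj X Y)).hom ≫ (D.aP X Y Z).inv)]
      conv_rhs => rw [h]
      simp only [hc Y Z, hc X Z, hc (D.pl.obj X Y) Z, Category.assoc, ← D.pl.map_comp_assoc,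
        Iso.inv_hom_id, Iso.hom_inv_id, Iso.inv_hom_id_assoc, Iso.hom_inv_id_assoc,
        Category.id_comp, Category.comp_id, D.pl.map_id, ← D.pl.map_comp]
    symmetry := hS }

open scoped MonoidalCategory in
theorem full_tensorRight_of_invertible [MonoidalCategory C] [BraidedCategory C] {X Y : C}
    (e : X ⊗ Y ≅ 𝟙_ C) : (MonoidalCategory.tensorRight X).Full := by
  have i : ∀ {A B : C}, (A ⊗ B ≅ 𝟙_ C) →
      (MonoidalCategory.tensorRight A ⋙ MonoidalCategory.tensorRight B ≅ 𝟭 C) := fun e =>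
    (MonoidalCategory.tensorRightTensor _ _).symm ≪≫
      (MonoidalCategory.tensoringRight C).mapIso e ≪≫ MonoidalCategory.rightUnitorNatIso C
  have : (MonoidalCategory.tensorRight Y ⋙ MonoidalCategory.tensorRight X).Faithful :=
    Functor.Faithful.of_iso (i (β_ Y X ≪≫ e)).symm
  have : (MonoidalCategory.tensorRight Y).Faithful :=
    Functor.Faithful.of_comp _ (MonoidalCategory.tensorRight X)
  have : (MonoidalCategory.tensorRight X ⋙ MonoidalCategory.tensorRight Y).Full :=
    Functor.Full.of_iso (i e).symm
  exact Functor.Full.of_comp_faithful _ (MonoidalCategory.tensorRight Y)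

theorem g_zero_eq_d_zero {D : Data C} (hP : pentP D) (hT : triP D) :
    (D.g D.zero).hom = (D.d D.zero).hom :=
  letI := addMonoidal D hP hT
  MonoidalCategory.unitors_equal (C := C)

theorem cP_hom_comp_g_hom {D : Data C} (hP : pentP D) (hT : triP D) (hH : hexP D) (hS : symP D)
    (A : C) : (D.cP A D.zero).hom ≫ (D.g A).hom = (D.d A).hom :=
  let _ := addMonoidal D hP hT
  let _ := addSymmetric D hP hT hH hS
  braiding_leftUnitor A

theorem exists_map_id_eq {D : Data C} (h : IsAnn D) {P A B : C}
    (f : D.pl.obj A P ⟶ D.pl.obj B P) : ∃ k : A ⟶ B, D.pl.map k (𝟙 P) = f := by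
  let _ := addMonoidal D h.hPentP h.hTriP
  let _ := addSymmetric D h.hPentP h.hTriP h.hHexP h.hSymP
  obtain ⟨P', ⟨e⟩⟩ := h.hInv P
  have := full_tensorRight_of_invertible (C := C) (X := P) (Y := P') e
  exact (MonoidalCategory.tensorRight P).map_surjective f

open scoped MonoidalCategory in
theorem v_eq_tensorμ {D : Data C} (hP : pentP D) (hT : triP D) (hH : hexP D) (hS : symP D)
    (U V Z T : C) :
    letI := addMonoidal D hP hT
    letI := addSymmetric D hP hT hH hS
    v D U V Z T = MonoidalCategory.tensorμ (C := C) U V Z T := by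
  let _ := addMonoidal D hP hT
  let _ := addSymmetric D hP hT hH hS
  rw [MonoidalCategory.tensorμ, ← MonoidalCategory.whiskerLeft_comp_assoc,
    ← MonoidalCategory.whiskerLeft_comp_assoc, Category.assoc]
  rfl

theorem v_natural {D : Data C} (hP : pentP D) (hT : triP D) (hH : hexP D) (hS : symP D)
    {U V Z T U' V' Z' T' : C} (f : U ⟶ U') (g : V ⟶ V') (h : Z ⟶ Z') (k : T ⟶ T') :
    D.pl.map (D.pl.map f g) (D.pl.map h k) ≫ v D U' V' Z' T'
      = v D U V Z T ≫ D.pl.map (D.pl.map f h) (D.pl.map g k) := by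
  let _ := addMonoidal D hP hT
  let _ := addSymmetric D hP hT hH hS
  rw [v_eq_tensorμ hP hT hH hS, v_eq_tensorμ hP hT hH hS]
  exact MonoidalCategory.tensorμ_natural f g h k

open scoped MonoidalCategory in
theorem v_zero {D : Data C} (hP : pentP D) (hT : triP D) (hH : hexP D) (hS : symP D) :
    v D D.zero D.zero D.zero D.zero ≫ D.pl.map (D.g D.zero).hom (D.g D.zero).hom
        ≫ (D.g D.zero).hom
      = D.pl.map (D.g D.zero).hom (D.g D.zero).hom ≫ (D.g D.zero).hom := by
  let _ := addMonoidal D hP hT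
  let _ := addSymmetric D hP hT hH hS
  rw [v_eq_tensorμ hP hT hH hS]
  have h := MonoidalCategory.tensor_left_unitality (𝟙_ C) (𝟙_ C)
  have h' := (λ_ (𝟙_ C)).hom ▷ (𝟙_ C ⊗ 𝟙_ C) ≫= h
  rw [MonoidalCategory.hom_inv_whiskerRight_assoc] at h'
  change MonoidalCategory.tensorμ _ _ _ _ ≫ ((λ_ (𝟙_ C)).hom ⊗ₘ (λ_ (𝟙_ C)).hom) ≫
    (λ_ (𝟙_ C)).hom = ((λ_ (𝟙_ C)).hom ⊗ₘ (λ_ (𝟙_ C)).hom) ≫ (λ_ (𝟙_ C)).hom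
  rw [← reassoc_of% h', MonoidalCategory.tensorHom_def, Category.assoc,
    MonoidalCategory.leftUnitor_naturality]

/-- `φ : P ⟶ 0` is compatible with the multiplication `t ∘ s⁻¹ : P ⊕ P ⟶ P`. -/
def IsCounit (D : Data C) {P Q : C} (s : Q ⟶ D.pl.obj P P) (t : Q ⟶ P) (φ : P ⟶ D.zero) : Prop :=
  s ≫ D.pl.map φ φ ≫ (D.g D.zero).hom = t ≫ φ

namespace IsCounit

variable {D : Data C}

theorem unique (h : IsAnn D) {P Q : C} {s : Q ⟶ D.pl.obj P P} {t : Q ⟶ P}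
    {φ ψ : P ⟶ D.zero} (hφ : IsCounit D s t φ) (hψ : IsCounit D s t ψ) : φ = ψ := by
  unfold IsCounit at *
  have := h.hGrpd s
  have := h.hGrpd φ
  have := h.hGrpd ψ
  obtain ⟨k, rfl⟩ : ∃ k, ψ = φ ≫ k := ⟨inv φ ≫ ψ, by simp⟩
  have := h.hGrpd k
  have h₁ : D.pl.map k k ≫ (D.g D.zero).hom = (D.g D.zero).hom ≫ k := by
    rw [← cancel_epi (D.pl.map φ φ), ← cancel_epi s, ← D.pl.map_comp_assoc, hψ, reassoc_of% hφ]
  have h₂ : D.pl.map k (𝟙 D.zero) ≫ (D.g D.zero).hom = (D.g D.zero).hom := by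
    rw [← cancel_mono k, ← h₁, Category.assoc, ← D.natG, ← D.pl.map_comp_assoc,
      Category.comp_id, Category.id_comp]
  have h₃ := D.natD k
  rw [← g_zero_eq_d_zero h.hPentP h.hTriP, h₂] at h₃
  have h₄ : k = 𝟙 _ := by rw [← cancel_epi (D.g D.zero).hom, ← h₃, Category.comp_id]
  rw [h₄, Category.comp_id]

theorem exists_iso (h : IsAnn D) {P Q : C} (s : Q ⟶ D.pl.obj P P) (t : Q ⟶ P) :
    ∃ φ : P ≅ D.zero, IsCounit D s t φ.hom := by
  have := h.hGrpd s
  obtain ⟨k, hk⟩ := exists_map_id_eq h (inv s ≫ t ≫ (D.g P).inv)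
  have := h.hGrpd k
  refine ⟨asIso k, ?_⟩
  have : D.pl.map k k = D.pl.map k (𝟙 P) ≫ D.pl.map (𝟙 _) k := by
    rw [← D.pl.map_comp, Category.comp_id, Category.id_comp]
  simp [IsCounit, this, hk, D.natG]

theorem comp {P P' Q Q' : C} {s : Q ⟶ D.pl.obj P P} {t : Q ⟶ P}
    {s' : Q' ⟶ D.pl.obj P' P'} {t' : Q' ⟶ P'} {φ : P' ⟶ D.zero} (hφ : IsCounit D s' t' φ)
    {θ : P ⟶ P'} {θ₂ : Q ⟶ Q'} (hs : s ≫ D.pl.map θ θ = θ₂ ≫ s') (ht : t ≫ θ = θ₂ ≫ t') :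
    IsCounit D s t (θ ≫ φ) := by
  unfold IsCounit at *
  rw [D.pl.map_comp, Category.assoc, reassoc_of% hs, hφ, reassoc_of% ht]

theorem id_zero : IsCounit D (𝟙 (D.pl.obj D.zero D.zero)) (D.g D.zero).hom (𝟙 D.zero) := by
  simp [IsCounit, D.pl.map_id]

/-- Functors `F` with a constraint `μ` preserve compatible morphisms to `0`. -/
theorem map (F : C ⥤ C) (μ : ∀ X Y, F.obj (D.pl.obj X Y) ⟶ D.pl.obj (F.obj X) (F.obj Y))
    (hμ : ∀ {X X' Y Y' : C} (f : X ⟶ X') (k : Y ⟶ Y'),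
      F.map (D.pl.map f k) ≫ μ X' Y' = μ X Y ≫ D.pl.map (F.map f) (F.map k))
    {P Q : C} {s : Q ⟶ D.pl.obj P P} {t : Q ⟶ P} {φ : P ⟶ D.zero} (hφ : IsCounit D s t φ)
    {ψ : F.obj D.zero ⟶ D.zero} (hψ : IsCounit D (μ D.zero D.zero) (F.map (D.g D.zero).hom) ψ) :
    IsCounit D (F.map s ≫ μ P P) (F.map t) (F.map φ ≫ ψ) := by
  unfold IsCounit at *
  rw [D.pl.map_comp]
  simp only [Category.assoc]
  rw [← reassoc_of% (hμ φ φ), hψ, ← F.map_comp_assoc, ← F.map_comp_assoc, ← F.map_comp_assoc,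
    Category.assoc, hφ]

theorem g_compat (h : IsAnn D) (F : C ⥤ C)
    (μ : ∀ X Y, F.obj (D.pl.obj X Y) ⟶ D.pl.obj (F.obj X) (F.obj Y))
    (hμ : ∀ {X X' Y Y' : C} (f : X ⟶ X') (k : Y ⟶ Y'),
      F.map (D.pl.map f k) ≫ μ X' Y' = μ X Y ≫ D.pl.map (F.map f) (F.map k))
    (hμa : ∀ X Y Z, F.map (D.aP X Y Z).hom ≫ μ (D.pl.obj X Y) Z ≫ D.pl.map (μ X Y) (𝟙 (F.obj Z))
      = μ X (D.pl.obj Y Z) ≫ D.pl.map (𝟙 (F.obj X)) (μ Y Z) ≫ (D.aP _ _ _).hom)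
    {φ : F.obj D.zero ⟶ D.zero} (hφ : IsCounit D (μ D.zero D.zero) (F.map (D.g D.zero).hom) φ)
    (X : C) : μ D.zero X ≫ D.pl.map φ (𝟙 _) ≫ (D.g (F.obj X)).hom = F.map (D.g X).hom := by
  unfold IsCounit at hφ
  let e : ∀ X, F.obj (D.pl.obj D.zero X) ⟶ F.obj X := fun X =>
    μ D.zero X ≫ D.pl.map φ (𝟙 _) ≫ (D.g (F.obj X)).hom
  have he : ∀ {X Y : C} (f : X ⟶ Y), F.map (D.pl.map (𝟙 D.zero) f) ≫ e Y = e X ≫ F.map f := by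
    intro X Y f
    simp only [e, Category.assoc]
    rw [reassoc_of% (hμ (𝟙 D.zero) f), ← D.natG, ← D.pl.map_comp_assoc, ← D.pl.map_comp_assoc,
      F.map_id, Category.id_comp, Category.comp_id, Category.id_comp, Category.comp_id]
  have hgg : (D.aP D.zero D.zero X).hom ≫ D.pl.map (D.g D.zero).hom (𝟙 X)
      = D.pl.map (𝟙 _) (D.g X).hom := by
    rw [g_zero_eq_d_zero h.hPentP h.hTriP, h.hTriP]
  have hgg' : (D.aP D.zero D.zero (F.obj X)).hom ≫ D.pl.map (D.g D.zero).hom (𝟙 _)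
      = D.pl.map (𝟙 _) (D.g (F.obj X)).hom := by
    rw [g_zero_eq_d_zero h.hPentP h.hTriP, h.hTriP]
  have h₁ : e (D.pl.obj D.zero X) ≫ e X = F.map (D.pl.map (𝟙 _) (D.g X).hom) ≫ e X := by
    have hl : e (D.pl.obj D.zero X) ≫ e X = (μ D.zero (D.pl.obj D.zero X) ≫
        D.pl.map (𝟙 _) (μ D.zero X) ≫ (D.aP _ _ _).hom) ≫
        D.pl.map (D.pl.map φ φ) (𝟙 _) ≫ D.pl.map (D.g D.zero).hom (𝟙 _) ≫ (D.g _).hom := by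
      simp only [e, Category.assoc]
      rw [← reassoc_of% (D.natAP φ φ (𝟙 (F.obj X))), reassoc_of% hgg', ← D.natG]
      simp only [← D.pl.map_comp_assoc, Category.id_comp, Category.comp_id]
    rw [hl, ← hμa, ← hgg, F.map_comp]
    simp only [e, Category.assoc]
    rw [reassoc_of% (hμ (D.g D.zero).hom (𝟙 X))]
    simp only [← D.pl.map_comp_assoc, Category.comp_id, hφ, F.map_id]
  have := h.hGrpd (e X)
  rw [cancel_mono] at h₁
  have h₂ := he (D.g X).hom
  rw [h₁] at h₂
  exact (cancel_epi _).1 h₂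

theorem d_compat (h : IsAnn D) (F : C ⥤ C)
    (μ : ∀ X Y, F.obj (D.pl.obj X Y) ⟶ D.pl.obj (F.obj X) (F.obj Y))
    (hμc : ∀ X Y, μ X Y ≫ (D.cP _ _).hom = F.map (D.cP X Y).hom ≫ μ Y X)
    {φ : F.obj D.zero ⟶ D.zero}
    (hg : ∀ X, μ D.zero X ≫ D.pl.map φ (𝟙 _) ≫ (D.g (F.obj X)).hom = F.map (D.g X).hom)
    (X : C) : μ X D.zero ≫ D.pl.map (𝟙 _) φ ≫ (D.d (F.obj X)).hom = F.map (D.d X).hom := by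
  have hc := cP_hom_comp_g_hom h.hPentP h.hTriP h.hHexP h.hSymP
  rw [← hc, ← hc, reassoc_of% (D.natCP (𝟙 (F.obj X)) φ), reassoc_of% (hμc X D.zero), hg, ← F.map_comp]

end IsCounit

/-- The functor `A ⊗ -`. -/
def leftTensor (D : Data C) (A : C) : C ⥤ C where
  obj X := D.tn.obj A X
  map f := D.tn.map (𝟙 A) f
  map_id X := D.tn.map_id A X
  map_comp f k := by rw [← D.tn.map_comp, Category.comp_id]

/-- The functor `- ⊗ A`. -/
def rightTensor (D : Data C) (A : C) : C ⥤ C where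
  obj X := D.tn.obj X A
  map f := D.tn.map f (𝟙 A)
  map_id X := D.tn.map_id X A
  map_comp f k := by rw [← D.tn.map_comp, Category.comp_id]

/-- `φ : A ⊗ 0 ⟶ 0` is the unit constraint of `(A ⊗ -, 𝔏)`. -/
abbrev IsHatL (D : Data C) (A : C) (φ : D.tn.obj A D.zero ⟶ D.zero) : Prop :=
  IsCounit D (D.dl A D.zero D.zero).hom (D.tn.map (𝟙 A) (D.g D.zero).hom) φ

/-- `φ : 0 ⊗ A ⟶ 0` is the unit constraint of `(- ⊗ A, ℜ)`. -/
abbrev IsHatR (D : Data C) (A : C) (φ : D.tn.obj D.zero A ⟶ D.zero) : Prop :=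
  IsCounit D (D.dr D.zero D.zero A).hom (D.tn.map (D.g D.zero).hom (𝟙 A)) φ

section hats

variable {D : Data C}

theorem IsCounit.map_left {A P Q : C} {s : Q ⟶ D.pl.obj P P} {t : Q ⟶ P} {φ : P ⟶ D.zero}
    (hφ : IsCounit D s t φ) {ψ : D.tn.obj A D.zero ⟶ D.zero} (hψ : IsHatL D A ψ) :
    IsCounit D (D.tn.map (𝟙 A) s ≫ (D.dl A P P).hom) (D.tn.map (𝟙 A) t)
      (D.tn.map (𝟙 A) φ ≫ ψ) :=
  hφ.map (leftTensor D A) (fun X Y => (D.dl A X Y).hom) (fun f k => D.natDL (𝟙 A) f k) hψ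

theorem IsCounit.map_right {A P Q : C} {s : Q ⟶ D.pl.obj P P} {t : Q ⟶ P} {φ : P ⟶ D.zero}
    (hφ : IsCounit D s t φ) {ψ : D.tn.obj D.zero A ⟶ D.zero} (hψ : IsHatR D A ψ) :
    IsCounit D (D.tn.map s (𝟙 A) ≫ (D.dr P P A).hom) (D.tn.map t (𝟙 A))
      (D.tn.map φ (𝟙 A) ≫ ψ) :=
  hφ.map (rightTensor D A) (fun X Y => (D.dr X Y A).hom) (fun f k => D.natDR f k (𝟙 A)) hψ

theorem IsHatL.isUL (h : IsAnn D) {hatL : ∀ A : C, D.tn.obj A D.zero ≅ D.zero}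
    (hL : ∀ A, IsHatL D A (hatL A).hom) : isUL D hatL := fun A X => by
  have hg := IsCounit.g_compat h (leftTensor D A) (fun X Y => (D.dl A X Y).hom)
    (fun f k => D.natDL (𝟙 A) f k) (fun X Y Z => h.hCompLaP A X Y Z) (hL A)
  exact ⟨hg X, IsCounit.d_compat h (leftTensor D A) (fun X Y => (D.dl A X Y).hom)
    (fun X Y => h.hCompLcP A X Y) hg X⟩

theorem IsHatR.isUR (h : IsAnn D) {hatR : ∀ A : C, D.tn.obj D.zero A ≅ D.zero}
    (hR : ∀ A, IsHatR D A (hatR A).hom) : isUR D hatR := fun A X => by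
  have hg := IsCounit.g_compat h (rightTensor D A) (fun X Y => (D.dr X Y A).hom)
    (fun f k => D.natDR f k (𝟙 A)) (fun X Y Z => h.hCompRaP X Y Z A) (hR A)
  exact ⟨hg X, IsCounit.d_compat h (rightTensor D A) (fun X Y => (D.dr X Y A).hom)
    (fun X Y => h.hCompRcP X Y A) hg X⟩

theorem IsHatL.add (h : IsAnn D) {A B : C} {φ : D.tn.obj A D.zero ⟶ D.zero}
    {ψ : D.tn.obj B D.zero ⟶ D.zero} (hφ : IsHatL D A φ) (hψ : IsHatL D B ψ) :
    IsHatL D (D.pl.obj A B)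
      ((D.dr A B D.zero).hom ≫ D.pl.map φ ψ ≫ (D.d D.zero).hom) := by
  rw [← g_zero_eq_d_zero h.hPentP h.hTriP]
  unfold IsHatL IsCounit at *
  have hn := D.natDR (𝟙 A) (𝟙 B) (D.g D.zero).hom
  rw [D.pl.map_id] at hn
  have hz := v_zero h.hPentP h.hTriP h.hHexP h.hSymP
  have hv := v_natural h.hPentP h.hTriP h.hHexP h.hSymP φ ψ φ ψ
  rw [reassoc_of% hn, ← D.pl.map_comp_assoc, ← hφ, ← hψ]
  simp only [D.pl.map_comp, Category.assoc]
  rw [← reassoc_of% (h.hD4 A B D.zero D.zero), ← reassoc_of% hv, hz]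

/-- In a symmetric Ann-category, the unit constraints of the functors `A ⊗ -` and `- ⊗ A`
satisfy Laplaza's axioms. -/
theorem IsSymAnn.isDistCat (h : IsSymAnn D) {hatL : ∀ A : C, D.tn.obj A D.zero ≅ D.zero}
    {hatR : ∀ A : C, D.tn.obj D.zero A ≅ D.zero} (hL : ∀ A, IsHatL D A (hatL A).hom)
    (hR : ∀ A, IsHatR D A (hatR A).hom) :
    IsDistCat { toData := D, hatL := hatL, hatR := hatR } := by
  obtain ⟨hb, hs⟩ := h
  have ha := hb.toIsAnn
  have h6 : ∀ A, (hatL A).hom = (D.br A D.zero).hom ≫ (hatR A).hom := fun A =>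
    (hL A).unique ha ((hR A).comp (hb.hD6 A D.zero D.zero) (D.natBr _ _))
  have h3 : ∀ A B, (hatL (D.pl.obj A B)).hom
      = (D.dr A B D.zero).hom ≫ D.pl.map (hatL A).hom (hatL B).hom ≫ (D.d D.zero).hom :=
    fun A B => (hL _).unique ha (IsHatL.add ha (hL A) (hL B))
  have h6' : ∀ A, (hatR A).hom = (D.br D.zero A).hom ≫ (hatL A).hom := fun A => by
    rw [h6, reassoc_of% (hs D.zero A)]
  exact
    { hPentP := ha.hPentP
      hTriP := ha.hTriP
      hHexP := ha.hHexP
      hSymP := ha.hSymP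
      hPentT := ha.hPentT
      hTriT := ha.hTriT
      hHexT1 := hb.hHex1
      hHexT2 := hb.hHex2
      hSymT := hs
      hNatHatL := fun {A A'} f => ((hL A).unique ha ((hL A').comp (θ₂ := D.tn.map f (𝟙 _))
        (D.natDL f (𝟙 D.zero) (𝟙 D.zero) |>.symm.trans (by simp [D.pl.map_id]))
        (by simp [← D.tn.map_comp]))).symm
      hNatHatR := fun {A A'} f => ((hR A).unique ha ((hR A').comp (θ₂ := D.tn.map (𝟙 _) f)
        (D.natDR (𝟙 D.zero) (𝟙 D.zero) f |>.symm.trans (by simp [D.pl.map_id]))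
        (by simp [← D.tn.map_comp]))).symm
      hCompLaP := ha.hCompLaP
      hCompLcP := ha.hCompLcP
      hCompRaP := ha.hCompRaP
      hCompRcP := ha.hCompRcP
      hD1 := ha.hD1
      hD2 := ha.hD2
      hD3 := ha.hD3
      hD4 := ha.hD4
      hD51 := ha.hD51
      hD52 := ha.hD52
      hD6 := hb.hD6
      hL1 := by
        have h00 : (D.br D.zero D.zero).hom = 𝟙 _ := hb.hC00
        exact (h6 D.zero).trans (by rw [h00, Category.id_comp])
      hL2 := fun A B => by
        change (hatR (D.pl.obj A B)).hom
          = (D.dl D.zero A B).hom ≫ D.pl.map (hatR A).hom (hatR B).hom ≫ (D.g D.zero).hom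
        rw [h6', h3, ← reassoc_of% (hb.hD6 D.zero A B), h6' A, h6' B, D.pl.map_comp_assoc,
          g_zero_eq_d_zero ha.hPentP ha.hTriP]
      hL3 := h3
      hL4 := ((hL D.one).unique ha (IsCounit.id_zero.comp
        ((ha.hD51 _ _).trans (Category.comp_id _).symm) (D.natL _))).trans (Category.comp_id _)
      hL5 := ((hR D.one).unique ha (IsCounit.id_zero.comp
        ((ha.hD52 _ _).trans (Category.comp_id _).symm) (D.natR _))).trans (Category.comp_id _)
      hL6 := h6
      hL7 := fun A B => (hR (D.tn.obj A B)).unique ha (((hR A).map_right (hR B)).comp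
        ((ha.hD2 D.zero D.zero A B).symm) (by rw [← D.natA, D.tn.map_id]))
      hL8 := fun A B => ((hR B).map_left (hL A)).unique ha (((hL A).map_right (hR B)).comp
        (by rw [Category.assoc]; exact (ha.hD3 A D.zero D.zero B).symm) (D.natA _ _ _))
      hL9 := fun A B => ((hL (D.tn.obj A B)).comp
        (by rw [Category.assoc]; exact (ha.hD1 A B D.zero D.zero).symm)
        (by rw [D.natA, D.tn.map_id])).unique ha ((hL B).map_left (hL A))
      hL10 := fun A X => (IsHatL.isUL ha hL A X).1
      hL11 := fun A X => (IsHatR.isUR ha hR A X).1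
      hL12 := fun A X => (IsHatL.isUL ha hL A X).2
      hL13 := fun A X => (IsHatR.isUR ha hR X A).2 }

end hats

end

/-- **Corollary 5.3.** A category with the data of bifunctors `⊕`, `⊗` and constraint
isomorphisms is a symmetric Ann-category iff (i) it is a distributivity category
(for suitable `L̂`, `R̂`) and (ii) all objects are invertible with respect to `⊕` and the
underlying category of `(𝒜, ⊕)` is a groupoid. -/
theorem stmt7 {C : Type u} [Category.{v} C] (D : Data C) :
    IsSymAnn D ↔
      ((∃ (hatL : ∀ A : C, D.tn.obj A D.zero ≅ D.zero)
          (hatR : ∀ A : C, D.tn.obj D.zero A ≅ D.zero),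
            IsDistCat { toData := D, hatL := hatL, hatR := hatR })
        ∧ invObjP D ∧ grpdP C) := by
  refine ⟨fun h => ?_, ?_⟩
  · have ha := h.1.toIsAnn
    choose hatL hL using fun A : C => IsCounit.exists_iso ha (D.dl A D.zero D.zero).hom
      (D.tn.map (𝟙 A) (D.g D.zero).hom)
    choose hatR hR using fun A : C => IsCounit.exists_iso ha (D.dr D.zero D.zero A).hom
      (D.tn.map (D.g D.zero).hom (𝟙 A))
    exact ⟨⟨hatL, hatR, h.isDistCat hL hR⟩, ha.hInv, ha.hGrpd⟩
  · rintro ⟨⟨hatL, hatR, h⟩, hInv, hGrpd⟩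
    refine ⟨?_, h.hSymT⟩
    exact
      { hPentP := h.hPentP
        hTriP := h.hTriP
        hHexP := h.hHexP
        hSymP := h.hSymP
        hGrpd := hGrpd
        hInv := hInv
        hPentT := h.hPentT
        hTriT := h.hTriT
        hCompLaP := h.hCompLaP
        hCompLcP := h.hCompLcP
        hCompRaP := h.hCompRaP
        hCompRcP := h.hCompRcP
        hD1 := h.hD1
        hD2 := h.hD2
        hD3 := h.hD3
        hD4 := h.hD4
        hD51 := h.hD51
        hD52 := h.hD52
        hHex1 := h.hHexT1
        hHex2 := h.hHexT2
        hD6 := h.hD6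
        hC00 := by
          have h₁ : (hatL D.zero).hom = (hatR D.zero).hom := h.hL1
          have h₆ : (hatL D.zero).hom = (D.br D.zero D.zero).hom ≫ (hatR D.zero).hom :=
            h.hL6 D.zero
          rw [c00, ← cancel_mono (hatR D.zero).hom, ← h₆, h₁, Category.id_comp] }

end AnnCat
end
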